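/- arXiv:2109.02939 — 4 statements merged into one kernel-verified Lean document; each statement's English description precedes it below -/
import Mathlib

section
/- Let ε₁,…,εₙ ∈ ℝ and let 𝔈 = diag(ε₁,…,εₙ). For every complex number z with Im z > 0, the matrix 𝔈 − z·Id − Σ(z) is invertible, i.e. det(𝔈 − z·Id − Σ(z)) ≠ 0. -/
open MeasureTheory Complex Matrix

lemma add_one_le_mul_norm_ofReal_sub (z : ℂ) (hz : 0 < z.im) (x : ℝ) :
    x + 1 ≤ (1 + (‖z‖ + 1) / z.im) * ‖(x : ℂ) - z‖ := by
  have him : z.im ≤ ‖(x : ℂ) - z‖ := by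
    have h := Complex.abs_im_le_norm ((x : ℂ) - z)
    simp only [sub_im, ofReal_im, zero_sub, abs_neg] at h
    exact (le_abs_self _).trans h
  have hre : x ≤ ‖(x : ℂ) - z‖ + ‖z‖ := by
    have h := norm_add_le ((x : ℂ) - z) z
    rw [sub_add_cancel, Complex.norm_real] at h
    exact (le_abs_self x).trans h
  have hdiv : ‖z‖ + 1 ≤ (‖z‖ + 1) / z.im * ‖(x : ℂ) - z‖ := by
    rw [div_mul_eq_mul_div, le_div_iff₀ hz]
    gcongr
  linarith

lemma integrable_mul_conj_div_ofReal_sub {ω : ℝ → ℝ} (hω : Measurable ω)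
    (hω_nonneg : ∀ k, 0 ≤ ω k) {f g : ℝ → ℂ} (hf : Measurable f) (hg : Measurable g)
    (hf_int : Integrable (fun k : ℝ => ‖f k‖ ^ 2 / (ω k + 1)))
    (hg_int : Integrable (fun k : ℝ => ‖g k‖ ^ 2 / (ω k + 1))) {z : ℂ} (hz : 0 < z.im) :
    Integrable (fun k : ℝ => f k * (starRingEnd ℂ) (g k) / ((ω k : ℂ) - z)) := by
  set C := 1 + (‖z‖ + 1) / z.im with hC
  refine ((hf_int.add hg_int).const_mul C).mono' ?_ (Filter.Eventually.of_forall fun k => ?_)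
  · have hg' : Measurable fun k => (starRingEnd ℂ) (g k) :=
      Complex.continuous_conj.measurable.comp hg
    exact ((hf.mul hg').div
      ((Complex.measurable_ofReal.comp hω).sub_const z)).aestronglyMeasurable
  · have hω1 : 0 < ω k + 1 := by linarith [hω_nonneg k]
    have hle := add_one_le_mul_norm_ofReal_sub z hz (ω k)
    rw [← hC] at hle
    have hC0 : 0 < C := by positivity
    have hd : 0 < ‖(ω k : ℂ) - z‖ := pos_of_mul_pos_right (hω1.trans_le hle) hC0.le
    rw [norm_div, norm_mul, RCLike.norm_conj, Pi.add_apply, ← add_div, ← mul_div_assoc,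
      div_le_div_iff₀ hd hω1]
    have hfg : ‖f k‖ * ‖g k‖ ≤ ‖f k‖ ^ 2 + ‖g k‖ ^ 2 := by
      nlinarith [sq_nonneg (‖f k‖ - ‖g k‖), sq_nonneg (‖f k‖), sq_nonneg (‖g k‖)]
    calc ‖f k‖ * ‖g k‖ * (ω k + 1)
        ≤ (‖f k‖ ^ 2 + ‖g k‖ ^ 2) * (C * ‖(ω k : ℂ) - z‖) := by gcongr
      _ = C * (‖f k‖ ^ 2 + ‖g k‖ ^ 2) * ‖(ω k : ℂ) - z‖ := by ring

lemma im_mul_conj_div_ofReal_sub_nonneg (w z : ℂ) (hz : 0 ≤ z.im) (x : ℝ) :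
    0 ≤ (w * (starRingEnd ℂ) w / ((x : ℂ) - z)).im := by
  rw [Complex.mul_conj, div_eq_mul_inv, Complex.im_ofReal_mul, Complex.inv_im]
  simp only [sub_im, ofReal_im, zero_sub, neg_neg]
  have := normSq_nonneg w
  have := normSq_nonneg ((x : ℂ) - z)
  positivity

/-- The self-energy has nonnegative imaginary part as a quadratic form, for `z` in the open upper
half-plane. -/
lemma im_star_dotProduct_selfEnergy_mulVec_nonneg {ι : Type*} [Fintype ι] {ω : ℝ → ℝ}
    (hω : Measurable ω) (hω_nonneg : ∀ k, 0 ≤ ω k) {F : ι → ℝ → ℂ} (hF : ∀ j, Measurable (F j))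
    (hF_int : ∀ j, Integrable (fun k : ℝ => ‖F j k‖ ^ 2 / (ω k + 1))) {z : ℂ} (hz : 0 < z.im)
    {A : Matrix ι ι ℂ}
    (hA : ∀ j l, A j l = ∫ k : ℝ, F j k * (starRingEnd ℂ) (F l k) / ((ω k : ℂ) - z))
    (v : ι → ℂ) : 0 ≤ (star v ⬝ᵥ (A *ᵥ v)).im := by
  have hint : ∀ j l, Integrable (fun k : ℝ =>
      star (v j) * (F j k * (starRingEnd ℂ) (F l k) / ((ω k : ℂ) - z) * v l)) := fun j l =>
    ((integrable_mul_conj_div_ofReal_sub hω hω_nonneg (hF j) (hF l) (hF_int j) (hF_int l)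
      hz).mul_const _).const_mul _
  have hsum : star v ⬝ᵥ (A *ᵥ v) = ∫ k : ℝ, ∑ j, ∑ l,
      star (v j) * (F j k * (starRingEnd ℂ) (F l k) / ((ω k : ℂ) - z) * v l) := by
    rw [integral_finsetSum _ fun j _ => integrable_finsetSum _ fun l _ => hint j l]
    simp only [dotProduct, mulVec, Finset.mul_sum, Pi.star_apply]
    refine Finset.sum_congr rfl fun j _ => ?_
    rw [integral_finsetSum _ fun l _ => hint j l]
    refine Finset.sum_congr rfl fun l _ => ?_
    rw [integral_const_mul, integral_mul_const, hA]
  have him := integral_im (integrable_finsetSum Finset.univ fun j _ =>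
    integrable_finsetSum Finset.univ fun l _ => hint j l)
  simp only [RCLike.im_to_complex] at him
  rw [hsum, ← him]
  refine integral_nonneg fun k => ?_
  have hsq : ∑ j, ∑ l, star (v j) * (F j k * (starRingEnd ℂ) (F l k) / ((ω k : ℂ) - z) * v l) =
      (∑ j, star (v j) * F j k) * (starRingEnd ℂ) (∑ j, star (v j) * F j k) / ((ω k : ℂ) - z) := by
    simp only [map_sum, map_mul, Finset.sum_mul_sum, Finset.sum_div]
    refine Finset.sum_congr rfl fun j _ => Finset.sum_congr rfl fun l _ => ?_
    simp only [RCLike.star_def, Complex.conj_conj]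
    ring
  exact (im_mul_conj_div_ofReal_sub_nonneg _ z hz.le (ω k)).trans_eq (congrArg im hsq.symm)

/-- With `𝔈 = diag(ε₁,…,εₙ)`, for every complex `z` in the open upper
half-plane the matrix `𝔈 − z·Id − Σ(z)` is invertible, i.e. its determinant is nonzero. -/
theorem det_selfEnergy_resolvent_ne_zero
    (n : ℕ) (hn : 1 ≤ n)
    (ω : ℝ → ℝ) (hω_cont : Continuous ω) (hω_nonneg : ∀ k, 0 ≤ ω k)
    (F : Fin n → ℝ → ℂ) (hF_meas : ∀ j, Measurable (F j))
    (hF_int : ∀ j, Integrable (fun k : ℝ => ‖F j k‖ ^ 2 / (ω k + 1)))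
    (S : ℂ → Matrix (Fin n) (Fin n) ℂ)
    (hS : ∀ z : ℂ, z.im ≠ 0 → ∀ j ℓ : Fin n,
      S z j ℓ = ∫ k : ℝ, F j k * (starRingEnd ℂ) (F ℓ k) / ((ω k : ℂ) - z))
    (ε : Fin n → ℝ) (z : ℂ) (hz : 0 < z.im) :
    (Matrix.diagonal (fun j => (ε j : ℂ)) - z • (1 : Matrix (Fin n) (Fin n) ℂ) - S z).det ≠ 0 := by
  intro hdet
  obtain ⟨v, hv, hMv⟩ := Matrix.exists_mulVec_eq_zero_iff.mpr hdet
  have hS_im := im_star_dotProduct_selfEnergy_mulVec_nonneg hω_cont.measurable hω_nonneg hF_meas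
    hF_int hz (hS z hz.ne') v
  have hpos : 0 < ∑ j, normSq (v j) := by
    obtain ⟨j, hj⟩ := Function.ne_iff.mp hv
    exact Finset.sum_pos' (fun i _ => normSq_nonneg _) ⟨j, Finset.mem_univ j, normSq_pos.mpr hj⟩
  have hform := congrArg (fun w => (star v ⬝ᵥ w).im) hMv
  simp only [sub_mulVec, dotProduct_sub, sub_im, smul_mulVec, one_mulVec, dotProduct_smul,
    dotProduct_zero, zero_im] at hform
  have hdiag : (star v ⬝ᵥ (diagonal (fun j => (ε j : ℂ)) *ᵥ v)).im = 0 := by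
    simp only [dotProduct, mulVec_diagonal, Pi.star_apply, im_sum]
    refine Finset.sum_eq_zero fun j _ => ?_
    simp only [RCLike.star_def, mul_im, mul_re, conj_re, conj_im, ofReal_re, ofReal_im]
    ring
  have hnorm : star v ⬝ᵥ v = ((∑ j, normSq (v j) : ℝ) : ℂ) := by
    simp only [dotProduct, Pi.star_apply, ofReal_sum, RCLike.star_def, normSq_eq_conj_mul_self]
  rw [hdiag, hnorm, smul_eq_mul, im_mul_ofReal] at hform
  nlinarith [mul_pos hz hpos]
end

section
/- Let x₁ ≤ x₂ ≤ … ≤ xₙ be real numbers with n ≥ 3, let κ ∈ ℂ, and for 1 ≤ m ≤ n let p_m(λ;κ) = det(Φ_m(κ) − λ·Id_m), where Φ_m(κ) is the phase matrix built from x₁,…,x_m. Then p₁(λ;κ) = 1 − λ, p₂(λ;κ) = (1−λ)² − e^{2iκ(x₂−x₁)}, and p_n(λ;κ) = [(1−λ) − (1+λ)·e^{2iκ(xₙ−x_{n−1})}]·p_{n−1}(λ;κ) − λ²·e^{2iκ(xₙ−x_{n−1})}·p_{n−2}(λ;κ) for every λ ∈ ℂ. -/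
open Complex Matrix

/-- The phase matrix `Φₘ(κ)` of points `x₁,…,xₘ`, with entries `exp(iκ|x_j − x_ℓ|)`. -/
noncomputable def phaseMatrix (m : ℕ) (x : Fin m → ℝ) (κ : ℂ) :
    Matrix (Fin m) (Fin m) ℂ :=
  Matrix.of fun j ℓ => Complex.exp (Complex.I * κ * (|x j - x ℓ| : ℝ))

/-- The characteristic polynomial `p_m(λ;κ) = det(Φₘ(κ) − λ·Id)` of the phase matrix. -/
noncomputable def phaseCharPoly (m : ℕ) (x : Fin m → ℝ) (κ lam : ℂ) : ℂ :=
  (phaseMatrix m x κ - lam • (1 : Matrix (Fin m) (Fin m) ℂ)).det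

/-- A determinant whose last row and last column vanish outside their last two entries. -/
lemma Matrix.det_eq_of_last_row_col_sparse {R : Type*} [CommRing R] {k : ℕ}
    (C : Matrix (Fin (k + 2)) (Fin (k + 2)) R)
    (hrow : ∀ j : Fin k, C (Fin.last _) j.castSucc.castSucc = 0)
    (hcol : ∀ i : Fin k, C i.castSucc.castSucc (Fin.last _) = 0) :
    C.det = C (Fin.last _) (Fin.last _) * (C.submatrix Fin.castSucc Fin.castSucc).det -
      C (Fin.last _) (Fin.last k).castSucc * C (Fin.last k).castSucc (Fin.last _) *
        (C.submatrix (fun i : Fin k => i.castSucc.castSucc)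
          (fun i : Fin k => i.castSucc.castSucc)).det := by
  have hminor : (C.submatrix Fin.castSucc (Fin.last k).castSucc.succAbove).det =
      C (Fin.last k).castSucc (Fin.last _) *
        (C.submatrix (fun i : Fin k => i.castSucc.castSucc)
          (fun i : Fin k => i.castSucc.castSucc)).det := by
    rw [det_succ_column _ (Fin.last k), Fin.sum_univ_castSucc]
    have hcomp : (Fin.last k).castSucc.succAbove ∘ Fin.castSucc =
        fun i : Fin k => i.castSucc.castSucc := by
      funext i
      exact Fin.succAbove_of_castSucc_lt _ _
        (Fin.castSucc_lt_castSucc_iff.2 (Fin.castSucc_lt_last i))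
    have hcomp' : (Fin.castSucc ∘ Fin.castSucc : Fin k → Fin (k + 2)) =
        fun i => i.castSucc.castSucc := rfl
    simp [hcol, Fin.succAbove_last, submatrix_submatrix, hcomp, hcomp', ← two_mul]
  rw [det_succ_row _ (Fin.last (k + 1)), Fin.sum_univ_castSucc, Fin.sum_univ_castSucc]
  simp only [Fin.succAbove_last, hrow, hminor]
  have h1 : (-1 : R) ^ (k + 1 + k) = -1 := Odd.neg_one_pow ⟨k, by ring⟩
  have h2 : (-1 : R) ^ (k + 1 + (k + 1)) = 1 := Even.neg_one_pow ⟨k + 1, rfl⟩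
  simp [h1, h2]
  ring

/-- Expansion of a determinant whose last row and column are `e` times the preceding ones, outside
the last two entries. -/
lemma Matrix.det_eq_of_last_row_col_smul {R : Type*} [CommRing R] {k : ℕ}
    (A : Matrix (Fin (k + 2)) (Fin (k + 2)) R) (e : R)
    (hrow : ∀ j : Fin k, A (Fin.last _) j.castSucc.castSucc =
      e * A (Fin.last k).castSucc j.castSucc.castSucc)
    (hcol : ∀ i : Fin k, A i.castSucc.castSucc (Fin.last _) =
      e * A i.castSucc.castSucc (Fin.last k).castSucc) :
    A.det = (A (Fin.last _) (Fin.last _) - e * A (Fin.last k).castSucc (Fin.last _) -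
          e * (A (Fin.last _) (Fin.last k).castSucc -
            e * A (Fin.last k).castSucc (Fin.last k).castSucc)) *
        (A.submatrix Fin.castSucc Fin.castSucc).det -
      (A (Fin.last _) (Fin.last k).castSucc -
          e * A (Fin.last k).castSucc (Fin.last k).castSucc) *
        (A (Fin.last k).castSucc (Fin.last _) -
          e * A (Fin.last k).castSucc (Fin.last k).castSucc) *
        (A.submatrix (fun i : Fin k => i.castSucc.castSucc)
          (fun i : Fin k => i.castSucc.castSucc)).det := by
  have hne : Fin.last (k + 1) ≠ (Fin.last k).castSucc := (Fin.castSucc_ne_last _).symm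
  have hne' (i : Fin (k + 1)) : i.castSucc ≠ Fin.last (k + 1) := Fin.castSucc_ne_last _
  rw [← det_updateRow_add_smul_self A hne (-e), ← det_updateCol_add_smul_self _ hne (-e),
    det_eq_of_last_row_col_sparse]
  · have h1 (B : Matrix (Fin (k + 2)) (Fin (k + 2)) R) (u v) :
        ((B.updateRow (Fin.last _) u).updateCol (Fin.last _) v).submatrix
          Fin.castSucc Fin.castSucc = B.submatrix Fin.castSucc Fin.castSucc := by
      ext i j
      simp [updateRow_apply, hne']
    have h2 (B : Matrix (Fin (k + 2)) (Fin (k + 2)) R) (u v) :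
        ((B.updateRow (Fin.last _) u).updateCol (Fin.last _) v).submatrix
          (fun i : Fin k => i.castSucc.castSucc) (fun i : Fin k => i.castSucc.castSucc) =
        B.submatrix (fun i : Fin k => i.castSucc.castSucc)
          (fun i : Fin k => i.castSucc.castSucc) := by
      ext i j
      simp [updateRow_apply, hne']
    rw [h1, h2]
    simp [updateRow_apply, hne']
    ring
  · intro j
    simp [updateRow_apply, hne', hrow]
  · intro i
    simp [updateRow_apply, hne', hcol]

/-- Truncating the phase matrix to a subfamily of points along an injection. -/
lemma det_submatrix_phaseMatrix_sub {m n : ℕ} (x : Fin n → ℝ) (κ lam : ℂ) (f : Fin m → Fin n)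
    (hf : Function.Injective f) :
    ((phaseMatrix n x κ - lam • (1 : Matrix (Fin n) (Fin n) ℂ)).submatrix f f).det =
      phaseCharPoly m (fun i => x (f i)) κ lam := by
  unfold phaseCharPoly
  congr 1
  ext i j
  simp [phaseMatrix, Matrix.one_apply, hf.eq_iff]

lemma phaseCharPoly_add_two (k : ℕ) (x : Fin (k + 2) → ℝ) (hx : Monotone x) (κ lam : ℂ) :
    phaseCharPoly (k + 2) x κ lam =
      ((1 - lam) - (1 + lam) * Complex.exp (2 * Complex.I * κ *
          ((x (Fin.last _) - x (Fin.last k).castSucc : ℝ) : ℂ))) *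
        phaseCharPoly (k + 1) (fun i => x i.castSucc) κ lam -
      lam ^ 2 * Complex.exp (2 * Complex.I * κ *
          ((x (Fin.last _) - x (Fin.last k).castSucc : ℝ) : ℂ)) *
        phaseCharPoly k (fun i => x i.castSucc.castSucc) κ lam := by
  have hne (i : Fin (k + 1)) : i.castSucc ≠ Fin.last (k + 1) := Fin.castSucc_ne_last _
  have hne' (i : Fin k) : i.castSucc ≠ Fin.last k := Fin.castSucc_ne_last _
  have hlast : x (Fin.last k).castSucc ≤ x (Fin.last (k + 1)) := hx (Fin.le_last _)
  have hle (i : Fin k) : x i.castSucc.castSucc ≤ x (Fin.last k).castSucc :=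
    hx (Fin.castSucc_le_castSucc_iff.2 (Fin.le_last _))
  have hle' (i : Fin k) : x i.castSucc.castSucc ≤ x (Fin.last (k + 1)) := (hle i).trans hlast
  set e : ℂ := Complex.exp (Complex.I * κ *
    ((x (Fin.last _) - x (Fin.last k).castSucc : ℝ) : ℂ)) with he
  have hsq : Complex.exp (2 * Complex.I * κ *
      ((x (Fin.last _) - x (Fin.last k).castSucc : ℝ) : ℂ)) = e * e := by
    rw [he, ← Complex.exp_add]
    ring_nf
  rw [hsq, ← det_submatrix_phaseMatrix_sub x κ lam Fin.castSucc (Fin.castSucc_injective _),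
    ← det_submatrix_phaseMatrix_sub x κ lam (fun i : Fin k => i.castSucc.castSucc)
      ((Fin.castSucc_injective _).comp (Fin.castSucc_injective _)), phaseCharPoly,
    Matrix.det_eq_of_last_row_col_smul _ e]
  · have h1 : phaseMatrix (k + 2) x κ (Fin.last _) (Fin.last k).castSucc = e := by
      rw [he, phaseMatrix, Matrix.of_apply, abs_of_nonneg (sub_nonneg.2 hlast)]
    have h2 : phaseMatrix (k + 2) x κ (Fin.last k).castSucc (Fin.last _) = e := by
      rw [he, phaseMatrix, Matrix.of_apply, abs_sub_comm, abs_of_nonneg (sub_nonneg.2 hlast)]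
    have h3 (i) : phaseMatrix (k + 2) x κ i i = 1 := by simp [phaseMatrix]
    simp only [Matrix.sub_apply, Matrix.smul_apply, Matrix.one_apply, h1, h2, h3, hne,
      (hne _).symm, if_true, if_false, smul_eq_mul, mul_one, mul_zero, sub_zero]
    ring
  · intro j
    simp only [Matrix.sub_apply, Matrix.smul_apply, Matrix.one_apply, (hne _).symm,
      Fin.castSucc_inj, (hne' _).symm, if_false, smul_zero, sub_zero, phaseMatrix,
      Matrix.of_apply, abs_of_nonneg (sub_nonneg.2 (hle j)), abs_of_nonneg (sub_nonneg.2 (hle' j))]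
    rw [he, ← Complex.exp_add]
    push_cast
    ring_nf
  · intro j
    simp only [Matrix.sub_apply, Matrix.smul_apply, Matrix.one_apply, hne,
      Fin.castSucc_inj, hne', if_false, smul_zero, sub_zero, phaseMatrix,
      Matrix.of_apply, abs_sub_comm (x j.castSucc.castSucc),
      abs_of_nonneg (sub_nonneg.2 (hle j)), abs_of_nonneg (sub_nonneg.2 (hle' j))]
    rw [he, ← Complex.exp_add]
    push_cast
    ring_nf

/-- Recurrence relation for the characteristic polynomial of the phase
matrix: `p₁ = 1 − λ`, `p₂ = (1−λ)² − e^{2iκ(x₂−x₁)}`, and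
`pₙ = [(1−λ) − (1+λ)e^{2iκ(xₙ−x_{n−1})}]·p_{n−1} − λ²·e^{2iκ(xₙ−x_{n−1})}·p_{n−2}`. -/
theorem phaseCharPoly_recurrence
    (n : ℕ) (hn : 3 ≤ n) (x : Fin n → ℝ) (hx : Monotone x) (κ lam : ℂ) :
    phaseCharPoly 1 (fun i => x (Fin.castLE (by omega) i)) κ lam = 1 - lam ∧
    phaseCharPoly 2 (fun i => x (Fin.castLE (by omega) i)) κ lam =
      (1 - lam) ^ 2 -
        Complex.exp (2 * Complex.I * κ * ((x ⟨1, by omega⟩ - x ⟨0, by omega⟩ : ℝ) : ℂ)) ∧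
    phaseCharPoly n x κ lam =
      ((1 - lam) - (1 + lam) *
          Complex.exp (2 * Complex.I * κ *
            ((x ⟨n - 1, by omega⟩ - x ⟨n - 2, by omega⟩ : ℝ) : ℂ))) *
        phaseCharPoly (n - 1) (fun i => x (Fin.castLE (by omega) i)) κ lam -
      lam ^ 2 *
        Complex.exp (2 * Complex.I * κ *
          ((x ⟨n - 1, by omega⟩ - x ⟨n - 2, by omega⟩ : ℝ) : ℂ)) *
        phaseCharPoly (n - 2) (fun i => x (Fin.castLE (by omega) i)) κ lam := by
  refine ⟨by simp [phaseCharPoly, phaseMatrix], ?_, ?_⟩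
  · rw [phaseCharPoly_add_two 0 (fun i => x (Fin.castLE (by omega) i))
      (hx.comp (Fin.strictMono_castLE (by omega)).monotone)]
    simp only [phaseCharPoly, phaseMatrix, Matrix.det_fin_zero]
    have h0 : x (Fin.castLE (by omega) (Fin.last 0).castSucc) = x ⟨0, by omega⟩ := rfl
    have h1 : x (Fin.castLE (by omega) (Fin.last (0 + 1))) = x ⟨1, by omega⟩ := rfl
    rw [h0, h1]
    simp
    ring
  · obtain ⟨k, rfl⟩ := Nat.exists_eq_add_of_le' (show 2 ≤ n by omega)
    exact phaseCharPoly_add_two k x hx κ lam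
end

section
/- Let m > 0, d ≥ 0, and let z ∈ ℂ with Re z > 0 and Im z > 0. Then ∫_{−∞}^{∞} e^{ikd} / ( √(k²+m²) · ( √(k²+m²) − z ) ) dk = 2πi · e^{i d √(z²−m²)} / √(z²−m²) − 2 ∫_m^{∞} z · e^{−ηd} / ( √(η²−m²) · ( z² + η² − m² ) ) dη, where on the left-hand side and in √(η²−m²) the positive real square root is taken, and √(z²−m²) denotes the principal branch of the complex square root. -/
open MeasureTheory Complex Real

lemma sq_add_sq_ne_zero_of_re_pos {a : ℂ} (ha : 0 < a.re) (k : ℝ) : (k : ℂ) ^ 2 + a ^ 2 ≠ 0 := by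
  intro h
  have hre := congrArg Complex.re h
  have him := congrArg Complex.im h
  simp [pow_two] at hre him
  have h0 : a.im = 0 := by
    have : a.re * a.im = 0 := by linarith
    rcases mul_eq_zero.mp this with h | h
    · exact absurd h ha.ne'
    · exact h
  rw [h0] at hre
  nlinarith [mul_self_nonneg k]

lemma integrable_inv_sq_add_sq {a : ℂ} (ha : 0 < a.re) :
    Integrable (fun k : ℝ => ((k : ℂ) ^ 2 + a ^ 2)⁻¹) := by
  have key (c : ℝ) : Integrable (fun k : ℝ => ((a.re) ^ 2)⁻¹ * (1 + (k * (a.re)⁻¹ + c) ^ 2)⁻¹) :=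
    ((integrable_inv_one_add_sq.comp_add_right c).comp_mul_right' (inv_ne_zero ha.ne')).const_mul _
  refine Integrable.mono' ((key (a.im / a.re)).add (key (-(a.im / a.re)))) ?_ ?_
  · exact (Continuous.inv₀ (by fun_prop) (sq_add_sq_ne_zero_of_re_pos ha)).aestronglyMeasurable
  · filter_upwards with k
    have e (c : ℝ) : ((a.re) ^ 2)⁻¹ * (1 + (k * (a.re)⁻¹ + c / a.re) ^ 2)⁻¹
        = ((k + c) ^ 2 + a.re ^ 2)⁻¹ := by
      rw [← mul_inv]
      congr 1
      field_simp
      ring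
    have h1 := e a.im
    have h2 := e (-a.im)
    rw [neg_div] at h2
    simp only [Pi.add_apply]
    rw [h1, h2, norm_inv]
    have hu : 0 < (k + a.im) ^ 2 + a.re ^ 2 := by positivity
    have hv : 0 < (k + -a.im) ^ 2 + a.re ^ 2 := by positivity
    have hn : ‖(k : ℂ) ^ 2 + a ^ 2‖ ^ 2
        = ((k + a.im) ^ 2 + a.re ^ 2) * ((k + -a.im) ^ 2 + a.re ^ 2) := by
      rw [Complex.sq_norm, Complex.normSq_apply]
      simp [pow_two]
      ring
    set u := (k + a.im) ^ 2 + a.re ^ 2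
    set v := (k + -a.im) ^ 2 + a.re ^ 2
    have hpos : 0 < ‖(k : ℂ) ^ 2 + a ^ 2‖ := norm_pos_iff.mpr (sq_add_sq_ne_zero_of_re_pos ha k)
    set N := ‖(k : ℂ) ^ 2 + a ^ 2‖
    have : u⁻¹ + v⁻¹ = (u + v) / N ^ 2 := by rw [hn]; field_simp; ring
    rw [this, inv_eq_one_div, div_le_div_iff₀ hpos (by positivity)]
    have : N ≤ u + v := by
      apply le_of_sq_le_sq _ (by positivity)
      nlinarith
    nlinarith

lemma integrable_exp_mul_I_div_sq_add_sq {a : ℂ} (ha : 0 < a.re) (x : ℝ) :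
    Integrable fun k : ℝ =>
      Complex.exp (Complex.I * (k : ℂ) * (x : ℂ)) / ((k : ℂ) ^ 2 + a ^ 2) := by
  simp_rw [div_eq_mul_inv]
  refine (integrable_inv_sq_add_sq ha).bdd_mul (c := 1)
    (Continuous.aestronglyMeasurable (by fun_prop)) (.of_forall fun k => ?_)
  simp [Complex.norm_exp]

lemma integrable_exp_neg_mul_abs {a : ℂ} (ha : 0 < a.re) :
    Integrable (fun x : ℝ => Complex.exp (-a * (|x| : ℝ))) := by
  rw [← integrableOn_univ, ← Set.Iic_union_Ioi (a := (0 : ℝ)), integrableOn_union]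
  constructor
  · refine (integrableOn_exp_mul_complex_Iic ha 0).congr_fun (fun x hx => ?_) measurableSet_Iic
    simp [abs_of_nonpos (Set.mem_Iic.mp hx)]
  · refine (integrableOn_exp_mul_complex_Ioi (a := -a) (by simpa) 0).congr_fun
      (fun x hx => ?_) measurableSet_Ioi
    simp [abs_of_pos (Set.mem_Ioi.mp hx)]

open FourierTransform in
lemma fourier_exp_neg_mul_abs {a : ℂ} (ha : 0 < a.re) (ξ : ℝ) :
    𝓕 (fun x : ℝ => Complex.exp (-a * (|x| : ℝ))) ξ =
      2 * a * (((2 * Real.pi * ξ : ℝ) : ℂ) ^ 2 + a ^ 2)⁻¹ := by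
  have hI : Integrable (fun v : ℝ => Complex.exp (↑(-2 * Real.pi * v * ξ) * Complex.I) •
      Complex.exp (-a * (|v| : ℝ))) := by
    refine (integrable_exp_neg_mul_abs ha).bdd_mul (c := 1)
      (Continuous.aestronglyMeasurable (by fun_prop)) (.of_forall fun k => ?_)
    rw [Complex.norm_exp_ofReal_mul_I]
  rw [Real.fourier_real_eq_integral_exp_smul, ← intervalIntegral.integral_Iic_add_Ioi
    (b := (0 : ℝ)) hI.integrableOn hI.integrableOn]
  have h1 : ∫ v : ℝ in Set.Iic 0, Complex.exp (↑(-2 * Real.pi * v * ξ) * Complex.I) •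
      Complex.exp (-a * (|v| : ℝ)) =
      ∫ v : ℝ in Set.Iic 0, Complex.exp ((a - 2 * Real.pi * ξ * Complex.I) * v) := by
    refine setIntegral_congr_fun measurableSet_Iic fun v hv => ?_
    simp only [smul_eq_mul, ← Complex.exp_add, abs_of_nonpos (Set.mem_Iic.mp hv)]
    push_cast
    congr 1
    ring
  have h2 : ∫ v : ℝ in Set.Ioi 0, Complex.exp (↑(-2 * Real.pi * v * ξ) * Complex.I) •
      Complex.exp (-a * (|v| : ℝ)) =
      ∫ v : ℝ in Set.Ioi 0, Complex.exp ((-a - 2 * Real.pi * ξ * Complex.I) * v) := by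
    refine setIntegral_congr_fun measurableSet_Ioi fun v hv => ?_
    simp only [smul_eq_mul, ← Complex.exp_add, abs_of_pos (Set.mem_Ioi.mp hv)]
    push_cast
    congr 1
    ring
  have r1 : 0 < (a - 2 * Real.pi * ξ * Complex.I).re := by simpa
  have r2 : (-a - 2 * Real.pi * ξ * Complex.I).re < 0 := by simpa
  rw [h1, h2, integral_exp_mul_complex_Iic r1, integral_exp_mul_complex_Ioi r2]
  have n1 : a - 2 * Real.pi * ξ * Complex.I ≠ 0 := fun h => by simp [h] at r1
  have n2 : -a - 2 * Real.pi * ξ * Complex.I ≠ 0 := fun h => by simp [h] at r2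
  have n3 := sq_add_sq_ne_zero_of_re_pos ha (2 * Real.pi * ξ)
  simp only [Complex.ofReal_zero, mul_zero, Complex.exp_zero]
  rw [← div_eq_mul_inv, div_add_div _ _ n1 n2, div_eq_div_iff (mul_ne_zero n1 n2) n3]
  push_cast
  ring_nf
  simp only [Complex.I_sq]
  ring

open FourierTransform in
/-- The Fourier integral of a Lorentzian with complex width, by Fourier inversion. -/
lemma integral_exp_mul_I_div_sq_add_sq {a : ℂ} (ha : 0 < a.re) {x : ℝ} (hx : 0 ≤ x) :
    ∫ k : ℝ, Complex.exp (Complex.I * (k : ℂ) * (x : ℂ)) / ((k : ℂ) ^ 2 + a ^ 2) =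
      Real.pi / a * Complex.exp (-a * x) := by
  have hF := funext (fourier_exp_neg_mul_abs ha)
  have hint : Integrable (𝓕 (fun x : ℝ => Complex.exp (-a * (|x| : ℝ)))) := by
    rw [hF]
    exact ((integrable_inv_sq_add_sq ha).comp_mul_left' (R := 2 * Real.pi)
      (by positivity)).const_mul _
  have hinv := congrFun (Continuous.fourierInv_fourier_eq (by fun_prop)
    (integrable_exp_neg_mul_abs ha) hint) x
  rw [Real.fourierInv_eq', hF] at hinv
  have := Measure.integral_comp_mul_left (fun k : ℝ => 2 * a *
    (Complex.exp (Complex.I * (k : ℂ) * (x : ℂ)) / ((k : ℂ) ^ 2 + a ^ 2))) (2 * Real.pi)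
  have h0 : a ≠ 0 := fun h => by simp [h] at ha
  rw [abs_of_nonneg hx] at hinv
  rw [← hinv]
  have e : ∫ v : ℝ, Complex.exp (↑(2 * Real.pi * inner ℝ v x) * Complex.I) •
      (2 * a * (((2 * Real.pi * v : ℝ) : ℂ) ^ 2 + a ^ 2)⁻¹) = _ := Eq.trans (by
        refine integral_congr_ae (.of_forall fun v => ?_)
        simp only [smul_eq_mul, div_eq_mul_inv, RCLike.inner_apply, conj_trivial]
        push_cast
        ring_nf) this
  rw [e, abs_of_pos (by positivity), Complex.real_smul, integral_const_mul]
  generalize ∫ k : ℝ, Complex.exp (Complex.I * (k : ℂ) * (x : ℂ)) / ((k : ℂ) ^ 2 + a ^ 2) = J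
  have : (Real.pi : ℂ) ≠ 0 := by simp [Real.pi_ne_zero]
  push_cast
  field_simp

lemma image_sqrt_sq_add_sq_Ioi {m : ℝ} (hm : 0 < m) :
    (fun s : ℝ => Real.sqrt (s ^ 2 + m ^ 2)) '' Set.Ioi 0 = Set.Ioi m := by
  ext η
  simp only [Set.mem_image, Set.mem_Ioi]
  constructor
  · rintro ⟨s, hs, rfl⟩
    exact Real.lt_sqrt_of_sq_lt (by nlinarith)
  · intro h
    have h' : 0 < η ^ 2 - m ^ 2 := by nlinarith
    refine ⟨Real.sqrt (η ^ 2 - m ^ 2), Real.sqrt_pos.mpr h', ?_⟩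
    rw [Real.sq_sqrt h'.le, sub_add_cancel, Real.sqrt_sq (by linarith)]

lemma injOn_sqrt_sq_add_sq_Ioi (m : ℝ) :
    Set.InjOn (fun s : ℝ => Real.sqrt (s ^ 2 + m ^ 2)) (Set.Ioi 0) := by
  intro s hs t ht h
  rw [Set.mem_Ioi] at hs ht
  have := (Real.sqrt_inj (by positivity) (by positivity)).mp h
  exact (pow_left_inj₀ hs.le ht.le two_ne_zero).mp (by linarith)

lemma hasDerivAt_sqrt_sq_add_sq {m : ℝ} (hm : 0 < m) (s : ℝ) :
    HasDerivAt (fun s : ℝ => Real.sqrt (s ^ 2 + m ^ 2)) (s / Real.sqrt (s ^ 2 + m ^ 2)) s := by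
  have := (((hasDerivAt_id s).pow 2).add_const (m ^ 2)).sqrt (by simp; positivity)
  refine this.congr_deriv ?_
  simp
  field_simp

lemma abs_deriv_smul_stieltjes_kernel {m : ℝ} (hm : 0 < m) (w : ℂ) {s : ℝ} (hs : 0 < s) :
    |s / Real.sqrt (s ^ 2 + m ^ 2)| • ((Real.sqrt (s ^ 2 + m ^ 2) : ℂ) /
      ((Real.sqrt ((Real.sqrt (s ^ 2 + m ^ 2)) ^ 2 - m ^ 2) : ℂ) *
        (w ^ 2 + (Real.sqrt (s ^ 2 + m ^ 2) : ℂ) ^ 2 - (m : ℂ) ^ 2))) =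
    ((s : ℂ) ^ 2 + w ^ 2)⁻¹ := by
  have hω : 0 < Real.sqrt (s ^ 2 + m ^ 2) := by positivity
  have hsq : Real.sqrt (s ^ 2 + m ^ 2) ^ 2 = s ^ 2 + m ^ 2 := Real.sq_sqrt (by positivity)
  have hsqc : (Real.sqrt (s ^ 2 + m ^ 2) : ℂ) ^ 2 = (s : ℂ) ^ 2 + (m : ℂ) ^ 2 := by
    exact_mod_cast congrArg (fun x : ℝ => (x : ℂ)) hsq
  have hω' : (Real.sqrt (s ^ 2 + m ^ 2) : ℂ) ≠ 0 := by exact_mod_cast hω.ne'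
  have hs' : (s : ℂ) ≠ 0 := by exact_mod_cast hs.ne'
  rw [abs_of_pos (by positivity), hsq, hsqc, add_sub_cancel_right, Real.sqrt_sq hs.le,
    Complex.real_smul, Complex.ofReal_div, div_mul_div_cancel₀ hω', ← div_div, div_self hs', one_div]
  congr 1
  ring

lemma integral_Ioi_inv_sq_add_sq {w : ℂ} (hw : 0 < w.re) :
    ∫ s in Set.Ioi (0 : ℝ), ((s : ℂ) ^ 2 + w ^ 2)⁻¹ = Real.pi / (2 * w) := by
  have h := integral_exp_mul_I_div_sq_add_sq hw le_rfl
  have hi := integrable_inv_sq_add_sq hw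
  simp only [Complex.ofReal_zero, mul_zero, Complex.exp_zero, mul_one, one_div] at h
  rw [← intervalIntegral.integral_Iic_add_Ioi (b := (0 : ℝ)) hi.integrableOn hi.integrableOn] at h
  have h2 := integral_comp_neg_Ioi 0 (fun s : ℝ => ((s : ℂ) ^ 2 + w ^ 2)⁻¹)
  simp only [Complex.ofReal_neg, neg_sq, neg_zero] at h2
  rw [← h2, ← two_mul] at h
  rw [mul_comm 2 w, ← div_div, ← h]
  ring

lemma integrableOn_stieltjes_kernel {m : ℝ} (hm : 0 < m) {w : ℂ} (hw : 0 < w.re) :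
    IntegrableOn (fun η : ℝ => (η : ℂ) /
      ((Real.sqrt (η ^ 2 - m ^ 2) : ℂ) * (w ^ 2 + (η : ℂ) ^ 2 - (m : ℂ) ^ 2))) (Set.Ioi m) := by
  rw [← image_sqrt_sq_add_sq_Ioi hm, integrableOn_image_iff_integrableOn_abs_deriv_smul
    measurableSet_Ioi (fun s _ => (hasDerivAt_sqrt_sq_add_sq hm s).hasDerivWithinAt)
    (injOn_sqrt_sq_add_sq_Ioi m)]
  exact (integrable_inv_sq_add_sq hw).integrableOn.congr_fun
    (fun s hs => (abs_deriv_smul_stieltjes_kernel hm w hs).symm) measurableSet_Ioi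

/-- Stieltjes-type representation of `1 / w` on the half-line `(m, ∞)`. -/
lemma integral_stieltjes_kernel {m : ℝ} (hm : 0 < m) {w : ℂ} (hw : 0 < w.re) :
    ∫ η in Set.Ioi m, (η : ℂ) /
      ((Real.sqrt (η ^ 2 - m ^ 2) : ℂ) * (w ^ 2 + (η : ℂ) ^ 2 - (m : ℂ) ^ 2)) =
    Real.pi / (2 * w) := by
  rw [← image_sqrt_sq_add_sq_Ioi hm, integral_image_eq_integral_abs_deriv_smul
    measurableSet_Ioi (fun s _ => (hasDerivAt_sqrt_sq_add_sq hm s).hasDerivWithinAt)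
    (injOn_sqrt_sq_add_sq_Ioi m), ← integral_Ioi_inv_sq_add_sq hw]
  exact setIntegral_congr_fun measurableSet_Ioi
    (fun s hs => abs_deriv_smul_stieltjes_kernel hm w hs)

lemma integrableOn_real_stieltjes_kernel {m : ℝ} (hm : 0 < m) (k : ℝ) :
    IntegrableOn (fun η : ℝ => η / (Real.sqrt (η ^ 2 - m ^ 2) * (k ^ 2 + η ^ 2))) (Set.Ioi m) ∧
    ∫ η in Set.Ioi m, η / (Real.sqrt (η ^ 2 - m ^ 2) * (k ^ 2 + η ^ 2)) =
      Real.pi / (2 * Real.sqrt (k ^ 2 + m ^ 2)) := by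
  have hw : 0 < ((Real.sqrt (k ^ 2 + m ^ 2) : ℝ) : ℂ).re := by
    rw [Complex.ofReal_re]; positivity
  have hi := integrableOn_stieltjes_kernel hm hw
  have hv := integral_stieltjes_kernel hm hw
  have e (η : ℝ) : (η : ℂ) / ((Real.sqrt (η ^ 2 - m ^ 2) : ℂ) *
      ((Real.sqrt (k ^ 2 + m ^ 2) : ℂ) ^ 2 + (η : ℂ) ^ 2 - (m : ℂ) ^ 2)) =
      ((η / (Real.sqrt (η ^ 2 - m ^ 2) * (k ^ 2 + η ^ 2)) : ℝ) : ℂ) := by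
    rw [← Complex.ofReal_pow (Real.sqrt (k ^ 2 + m ^ 2)), Real.sq_sqrt (by positivity)]
    push_cast
    congr 2
    ring
  simp only [e] at hi hv
  rw [integral_complex_ofReal] at hv
  have hi' := hi.re
  simp only [RCLike.re_to_complex, Complex.ofReal_re] at hi'
  exact ⟨hi', by exact_mod_cast hv⟩

lemma integrable_fubini_kernel {m : ℝ} (hm : 0 < m) {a : ℂ} (ha : 0 < a.re) (d : ℝ) :
    Integrable (Function.uncurry fun k η : ℝ =>
      Complex.exp (Complex.I * (k : ℂ) * (d : ℂ)) / ((k : ℂ) ^ 2 + a ^ 2) *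
        ((η / (Real.sqrt (η ^ 2 - m ^ 2) * (k ^ 2 + η ^ 2)) : ℝ) : ℂ))
      (volume.prod (volume.restrict (Set.Ioi m))) := by
  have hA := integrable_exp_mul_I_div_sq_add_sq ha d
  have hmeas : Measurable (Function.uncurry fun k η : ℝ =>
      Complex.exp (Complex.I * (k : ℂ) * (d : ℂ)) / ((k : ℂ) ^ 2 + a ^ 2) *
        ((η / (Real.sqrt (η ^ 2 - m ^ 2) * (k ^ 2 + η ^ 2)) : ℝ) : ℂ)) := by
    unfold Function.uncurry
    fun_prop
  rw [integrable_prod_iff hmeas.aestronglyMeasurable]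
  refine ⟨.of_forall fun k => ((integrableOn_real_stieltjes_kernel hm k).1.ofReal).const_mul
    (Complex.exp (Complex.I * (k : ℂ) * (d : ℂ)) / ((k : ℂ) ^ 2 + a ^ 2)), ?_⟩
  have e (k : ℝ) : ∫ η in Set.Ioi m, ‖Function.uncurry (fun k η : ℝ =>
      Complex.exp (Complex.I * (k : ℂ) * (d : ℂ)) / ((k : ℂ) ^ 2 + a ^ 2) *
        ((η / (Real.sqrt (η ^ 2 - m ^ 2) * (k ^ 2 + η ^ 2)) : ℝ) : ℂ)) (k, η)‖ =
      Real.pi / (2 * Real.sqrt (k ^ 2 + m ^ 2)) *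
        ‖Complex.exp (Complex.I * (k : ℂ) * (d : ℂ)) / ((k : ℂ) ^ 2 + a ^ 2)‖ := by
    rw [← (integrableOn_real_stieltjes_kernel hm k).2, mul_comm, ← integral_const_mul]
    refine setIntegral_congr_fun measurableSet_Ioi fun η hη => ?_
    have hη' : 0 < η := hm.trans hη
    simp only [Function.uncurry, norm_mul]
    rw [Complex.norm_real, Real.norm_of_nonneg (by positivity)]
  simp only [e]
  refine hA.norm.bdd_mul (c := Real.pi / (2 * m))
    (Measurable.aestronglyMeasurable (by fun_prop)) (.of_forall fun k => ?_)
  rw [Real.norm_of_nonneg (by positivity)]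
  gcongr
  exact Real.le_sqrt_of_sq_le (by nlinarith)

lemma integral_exp_mul_I_div_mul_sq_add_sq {a : ℂ} (ha : 0 < a.re) {η : ℝ} (hη : 0 < η)
    (hne : (η : ℂ) ^ 2 - a ^ 2 ≠ 0) {d : ℝ} (hd : 0 ≤ d) :
    ∫ k : ℝ, Complex.exp (Complex.I * (k : ℂ) * (d : ℂ)) / ((k : ℂ) ^ 2 + a ^ 2) *
        ((k : ℂ) ^ 2 + (η : ℂ) ^ 2)⁻¹ =
      (Real.pi / a * Complex.exp (-a * d) - Real.pi / η * Complex.exp (-(η : ℂ) * d)) /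
        ((η : ℂ) ^ 2 - a ^ 2) := by
  have hη' : 0 < (η : ℂ).re := by simpa
  rw [← integral_exp_mul_I_div_sq_add_sq ha hd, ← integral_exp_mul_I_div_sq_add_sq hη' hd,
    ← integral_sub (integrable_exp_mul_I_div_sq_add_sq ha d)
      (integrable_exp_mul_I_div_sq_add_sq hη' d), ← integral_div]
  refine integral_congr_ae (.of_forall fun k => ?_)
  have h1 := sq_add_sq_ne_zero_of_re_pos ha k
  have h2 := sq_add_sq_ne_zero_of_re_pos hη' k
  simp only
  field_simp
  ring

lemma sq_add_sq_sub_sq_ne_zero {m : ℝ} {w : ℂ} (hw : 0 < w.re) {η : ℝ} (hm : 0 < m) (hη : m < η) :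
    w ^ 2 + (η : ℂ) ^ 2 - (m : ℂ) ^ 2 ≠ 0 := by
  have h := sq_add_sq_ne_zero_of_re_pos hw (Real.sqrt (η ^ 2 - m ^ 2))
  rw [← Complex.ofReal_pow, Real.sq_sqrt (by nlinarith)] at h
  push_cast at h
  convert h using 1
  ring

lemma integrableOn_exp_neg_mul_div_cut {m d : ℝ} (hm : 0 < m) (hd : 0 ≤ d) {w : ℂ}
    (hw : 0 < w.re) :
    IntegrableOn (fun η : ℝ => Complex.exp (-(η : ℂ) * (d : ℂ)) /
      ((Real.sqrt (η ^ 2 - m ^ 2) : ℂ) * (w ^ 2 + (η : ℂ) ^ 2 - (m : ℂ) ^ 2))) (Set.Ioi m) := by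
  have h := (integrableOn_stieltjes_kernel hm hw).bdd_mul (c := 1 / m)
    (f := fun η : ℝ => Complex.exp (-(η : ℂ) * (d : ℂ)) / η)
    (Measurable.aestronglyMeasurable (by fun_prop)) (by
      refine (ae_restrict_iff' measurableSet_Ioi).mpr (.of_forall fun η hη => ?_)
      have hη' : m < η := hη
      have hη0 : 0 < η := hm.trans hη
      rw [norm_div, Complex.norm_exp, Complex.norm_real, Real.norm_of_nonneg hη0.le]
      have : Real.exp (-(η : ℂ) * (d : ℂ)).re ≤ 1 := by
        rw [Real.exp_le_one_iff]
        simp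
        positivity
      gcongr)
  refine IntegrableOn.congr_fun h (fun η hη => ?_) measurableSet_Ioi
  have hη0 : (η : ℂ) ≠ 0 := by exact_mod_cast (hm.trans hη).ne'
  rw [div_mul_div_comm, mul_comm (Complex.exp _) (η : ℂ), mul_div_mul_left _ _ hη0]

/-- Swapping the integrals after inserting the Stieltjes representation of `1 / √(k² + m²)`. -/
lemma integral_exp_mul_I_div_sqrt_mul_sq_add_sq {m d : ℝ} (hm : 0 < m) (hd : 0 ≤ d) {a w : ℂ}
    (ha : 0 < a.re) (hw : 0 < w.re) (haw : w ^ 2 + a ^ 2 = (m : ℂ) ^ 2) :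
    ∫ k : ℝ, Complex.exp (Complex.I * (k : ℂ) * (d : ℂ)) / ((k : ℂ) ^ 2 + a ^ 2) /
        (Real.sqrt (k ^ 2 + m ^ 2) : ℂ) =
      Real.pi / (a * w) * Complex.exp (-a * d) -
        2 * ∫ η in Set.Ioi m, Complex.exp (-(η : ℂ) * (d : ℂ)) /
          ((Real.sqrt (η ^ 2 - m ^ 2) : ℂ) * (w ^ 2 + (η : ℂ) ^ 2 - (m : ℂ) ^ 2)) := by
  have ha0 : a ≠ 0 := fun h => by simp [h] at ha
  have hw0 : w ≠ 0 := fun h => by simp [h] at hw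
  have hswap := integral_integral_swap (integrable_fubini_kernel hm ha d)
  have hleft (k : ℝ) : ∫ η in Set.Ioi m,
      Complex.exp (Complex.I * (k : ℂ) * (d : ℂ)) / ((k : ℂ) ^ 2 + a ^ 2) *
        ((η / (Real.sqrt (η ^ 2 - m ^ 2) * (k ^ 2 + η ^ 2)) : ℝ) : ℂ) =
      Real.pi / 2 * (Complex.exp (Complex.I * (k : ℂ) * (d : ℂ)) / ((k : ℂ) ^ 2 + a ^ 2) /
        (Real.sqrt (k ^ 2 + m ^ 2) : ℂ)) := by
    rw [integral_const_mul, integral_complex_ofReal, (integrableOn_real_stieltjes_kernel hm k).2]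
    push_cast
    ring
  have hright : ∫ η in Set.Ioi m, ∫ k : ℝ,
      Complex.exp (Complex.I * (k : ℂ) * (d : ℂ)) / ((k : ℂ) ^ 2 + a ^ 2) *
        ((η / (Real.sqrt (η ^ 2 - m ^ 2) * (k ^ 2 + η ^ 2)) : ℝ) : ℂ) =
      ∫ η in Set.Ioi m, (Real.pi / a * Complex.exp (-a * d) * ((η : ℂ) /
        ((Real.sqrt (η ^ 2 - m ^ 2) : ℂ) * (w ^ 2 + (η : ℂ) ^ 2 - (m : ℂ) ^ 2))) -
        Real.pi * (Complex.exp (-(η : ℂ) * (d : ℂ)) /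
          ((Real.sqrt (η ^ 2 - m ^ 2) : ℂ) * (w ^ 2 + (η : ℂ) ^ 2 - (m : ℂ) ^ 2)))) := by
    refine setIntegral_congr_fun measurableSet_Ioi fun η hη => ?_
    have hη0 : 0 < η := hm.trans hη
    have hηc : (η : ℂ) ≠ 0 := by exact_mod_cast hη0.ne'
    have hs : (Real.sqrt (η ^ 2 - m ^ 2) : ℂ) ≠ 0 := by
      have : 0 < Real.sqrt (η ^ 2 - m ^ 2) :=
        Real.sqrt_pos.mpr (by nlinarith [Set.mem_Ioi.mp hη])
      exact_mod_cast this.ne'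
    have hden : w ^ 2 + (η : ℂ) ^ 2 - (m : ℂ) ^ 2 = (η : ℂ) ^ 2 - a ^ 2 := by rw [← haw]; ring
    have hne := sq_add_sq_sub_sq_ne_zero hw hm hη
    rw [hden] at hne
    simp only [hden]
    calc _ = ∫ k : ℝ, (η : ℂ) / (Real.sqrt (η ^ 2 - m ^ 2) : ℂ) *
          (Complex.exp (Complex.I * (k : ℂ) * (d : ℂ)) / ((k : ℂ) ^ 2 + a ^ 2) *
            ((k : ℂ) ^ 2 + (η : ℂ) ^ 2)⁻¹) := by
          refine integral_congr_ae (.of_forall fun k => ?_)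
          simp only [div_eq_mul_inv, mul_inv]
          push_cast
          ring
      _ = _ := by
          rw [integral_const_mul, integral_exp_mul_I_div_mul_sq_add_sq ha hη0 hne hd]
          field_simp
  simp only [hleft] at hswap
  rw [hright, integral_const_mul, integral_sub ((integrableOn_stieltjes_kernel hm hw).const_mul _)
    ((integrableOn_exp_neg_mul_div_cut hm hd hw).const_mul _), integral_const_mul,
    integral_const_mul, integral_stieltjes_kernel hm hw] at hswap
  generalize ∫ k : ℝ, Complex.exp (Complex.I * (k : ℂ) * (d : ℂ)) / ((k : ℂ) ^ 2 + a ^ 2) /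
        (Real.sqrt (k ^ 2 + m ^ 2) : ℂ) = J at hswap ⊢
  generalize ∫ η in Set.Ioi m, Complex.exp (-(η : ℂ) * (d : ℂ)) /
          ((Real.sqrt (η ^ 2 - m ^ 2) : ℂ) * (w ^ 2 + (η : ℂ) ^ 2 - (m : ℂ) ^ 2)) = L at hswap ⊢
  have : (Real.pi : ℂ) / 2 ≠ 0 := by simp
  apply mul_left_cancel₀ this
  rw [hswap]
  field_simp

lemma integrable_exp_mul_I_div_sqrt_mul_sq_add_sq {m : ℝ} (hm : 0 < m) (d : ℝ) {a : ℂ}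
    (ha : 0 < a.re) :
    Integrable fun k : ℝ => Complex.exp (Complex.I * (k : ℂ) * (d : ℂ)) / ((k : ℂ) ^ 2 + a ^ 2) /
        (Real.sqrt (k ^ 2 + m ^ 2) : ℂ) := by
  simp_rw [div_eq_mul_inv _ (Real.sqrt _ : ℂ)]
  refine (integrable_exp_mul_I_div_sq_add_sq ha d).mul_bdd (c := m⁻¹)
    (Measurable.aestronglyMeasurable (by fun_prop)) (.of_forall fun k => ?_)
  rw [norm_inv, Complex.norm_real, Real.norm_of_nonneg (by positivity)]
  gcongr
  exact Real.le_sqrt_of_sq_le (by nlinarith)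

lemma cpow_one_half_im_pos {x : ℂ} (hx : 0 < x.im) : 0 < (x ^ ((1 : ℂ) / 2)).im := by
  rw [one_div, Complex.cpow_inv_two_im_eq_sqrt hx.le]
  have := Complex.abs_re_lt_norm.mpr hx.ne'
  exact Real.sqrt_pos.mpr (by linarith [(abs_lt.mp this).2])

/-- The waveguide-QED self-energy integral: for `m > 0`, `d ≥ 0` and `z`
with `Re z > 0`, `Im z > 0`,
`∫ e^{ikd}/(√(k²+m²)(√(k²+m²) − z)) dk
  = 2πi e^{id√(z²−m²)}/√(z²−m²) − 2∫_m^∞ z e^{−ηd}/(√(η²−m²)(z²+η²−m²)) dη`,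
where `√(z²−m²)` is the principal branch of the complex square root. -/
theorem waveguide_selfEnergy_integral
    (m d : ℝ) (hm : 0 < m) (hd : 0 ≤ d)
    (z : ℂ) (hre : 0 < z.re) (him : 0 < z.im) :
    ∫ k : ℝ, Complex.exp (Complex.I * (k : ℂ) * (d : ℂ)) /
        ((Real.sqrt (k ^ 2 + m ^ 2) : ℂ) * ((Real.sqrt (k ^ 2 + m ^ 2) : ℂ) - z)) =
      2 * (Real.pi : ℂ) * Complex.I *
          Complex.exp (Complex.I * (d : ℂ) * (z ^ 2 - (m : ℂ) ^ 2) ^ ((1 : ℂ) / 2)) /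
          (z ^ 2 - (m : ℂ) ^ 2) ^ ((1 : ℂ) / 2) -
        2 * ∫ η in Set.Ioi m, z * Complex.exp (-(η : ℂ) * (d : ℂ)) /
          ((Real.sqrt (η ^ 2 - m ^ 2) : ℂ) * (z ^ 2 + (η : ℂ) ^ 2 - (m : ℂ) ^ 2)) := by
  have hp : 0 < ((z ^ 2 - (m : ℂ) ^ 2) ^ ((1 : ℂ) / 2)).im := by
    apply cpow_one_half_im_pos
    simp [pow_two]
    nlinarith [mul_pos hre him]
  have hp2 : ((z ^ 2 - (m : ℂ) ^ 2) ^ ((1 : ℂ) / 2)) ^ 2 = z ^ 2 - (m : ℂ) ^ 2 := by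
    rw [one_div]
    exact Complex.cpow_ofNat_inv_pow _ 2
  generalize (z ^ 2 - (m : ℂ) ^ 2) ^ ((1 : ℂ) / 2) = p at hp hp2 ⊢
  have ha : 0 < (-Complex.I * p).re := by simpa
  have ha2 : (-Complex.I * p) ^ 2 = (m : ℂ) ^ 2 - z ^ 2 := by
    rw [mul_pow, hp2, neg_sq, Complex.I_sq]; ring
  have hp0 : p ≠ 0 := fun h => by simp [h] at hp
  have hz0 : z ≠ 0 := fun h => by simp [h] at hre
  have hsplit (k : ℝ) : Complex.exp (Complex.I * (k : ℂ) * (d : ℂ)) /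
        ((Real.sqrt (k ^ 2 + m ^ 2) : ℂ) * ((Real.sqrt (k ^ 2 + m ^ 2) : ℂ) - z)) =
      Complex.exp (Complex.I * (k : ℂ) * (d : ℂ)) / ((k : ℂ) ^ 2 + (-Complex.I * p) ^ 2) +
      z * (Complex.exp (Complex.I * (k : ℂ) * (d : ℂ)) / ((k : ℂ) ^ 2 + (-Complex.I * p) ^ 2) /
        (Real.sqrt (k ^ 2 + m ^ 2) : ℂ)) := by
    have hsq : (Real.sqrt (k ^ 2 + m ^ 2) : ℂ) ^ 2 = (k : ℂ) ^ 2 + (m : ℂ) ^ 2 := by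
      exact_mod_cast congrArg (fun x : ℝ => (x : ℂ))
        (Real.sq_sqrt (by positivity : 0 ≤ k ^ 2 + m ^ 2))
    have hω : (Real.sqrt (k ^ 2 + m ^ 2) : ℂ) ≠ 0 := by
      have : 0 < Real.sqrt (k ^ 2 + m ^ 2) := by positivity
      exact_mod_cast this.ne'
    have hfac : (k : ℂ) ^ 2 + (-Complex.I * p) ^ 2 =
        ((Real.sqrt (k ^ 2 + m ^ 2) : ℂ) - z) * ((Real.sqrt (k ^ 2 + m ^ 2) : ℂ) + z) := by
      rw [ha2]; linear_combination -hsq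
    have hne := sq_add_sq_ne_zero_of_re_pos ha k
    rw [hfac] at hne ⊢
    have h1 := left_ne_zero_of_mul hne
    have h2 := right_ne_zero_of_mul hne
    field_simp
  have hcut : ∫ η in Set.Ioi m, z * Complex.exp (-(η : ℂ) * (d : ℂ)) /
          ((Real.sqrt (η ^ 2 - m ^ 2) : ℂ) * (z ^ 2 + (η : ℂ) ^ 2 - (m : ℂ) ^ 2)) =
      z * ∫ η in Set.Ioi m, Complex.exp (-(η : ℂ) * (d : ℂ)) /
          ((Real.sqrt (η ^ 2 - m ^ 2) : ℂ) * (z ^ 2 + (η : ℂ) ^ 2 - (m : ℂ) ^ 2)) := by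
    rw [← integral_const_mul]
    simp only [mul_div_assoc]
  simp only [hsplit]
  rw [integral_add (integrable_exp_mul_I_div_sq_add_sq ha d)
    ((integrable_exp_mul_I_div_sqrt_mul_sq_add_sq hm d ha).const_mul z), integral_const_mul,
    integral_exp_mul_I_div_sq_add_sq ha hd,
    integral_exp_mul_I_div_sqrt_mul_sq_add_sq hm hd ha hre (by rw [ha2]; ring), hcut]
  have hexp : -(-Complex.I * p) * (d : ℂ) = Complex.I * d * p := by ring
  have hinv : (Real.pi : ℂ) / (-Complex.I * p) = Real.pi * Complex.I / p := by
    rw [div_eq_div_iff (mul_ne_zero (neg_ne_zero.mpr Complex.I_ne_zero) hp0) hp0]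
    linear_combination (Real.pi * p : ℂ) * Complex.I_sq
  rw [hexp, ← div_div (Real.pi : ℂ) _ z, hinv]
  field_simp
  ring
end

section
/- Let x₁,…,xₙ be real numbers, k ∈ ℝ, and η ≥ 0, and let C be the real symmetric n×n matrix with entries C_{jℓ} = e^{−η|x_j−x_ℓ|}·cos(k(x_j − x_ℓ)). Then C is positive semidefinite; moreover, if η > 0 and the points x₁,…,xₙ are pairwise distinct, then C is positive definite. -/
open Complex Matrix
open scoped ComplexOrder

/-- The cosine matrix: the Hermitian part of the phase matrix `Φₙ(k + iη)`, with entries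
`e^{−η|x_j − x_ℓ|}·cos(k(x_j − x_ℓ))`. -/
noncomputable def cosMatrix (n : ℕ) (x : Fin n → ℝ) (k η : ℝ) :
    Matrix (Fin n) (Fin n) ℂ :=
  Matrix.of fun j ℓ =>
    ((Real.exp (-η * |x j - x ℓ|) * Real.cos (k * (x j - x ℓ)) : ℝ) : ℂ)

/-- Splitting off the index of the smallest parameter from the quadratic form of the
shifted min-kernel. -/
theorem sum_min_sub_insert {ι : Type*} [DecidableEq ι] (t : ι → ℝ) (a : ι → ℂ) (m : ι)
    (s : Finset ι) (hm : m ∉ s) (hmin : ∀ i ∈ s, t m ≤ t i) (c : ℝ) :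
    ∑ i ∈ insert m s, ∑ j ∈ insert m s, star (a i) * ((min (t i) (t j) - c : ℝ) : ℂ) * a j =
      ((t m - c : ℝ) : ℂ) * (star (∑ i ∈ insert m s, a i) * ∑ i ∈ insert m s, a i) +
        ∑ i ∈ s, ∑ j ∈ s, star (a i) * ((min (t i) (t j) - t m : ℝ) : ℂ) * a j := by
  have hsplit : ∑ i ∈ s, ∑ j ∈ s, star (a i) * ((min (t i) (t j) - t m : ℝ) : ℂ) * a j =
      ∑ i ∈ insert m s, ∑ j ∈ insert m s,
        star (a i) * ((min (t i) (t j) - t m : ℝ) : ℂ) * a j := by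
    rw [Finset.sum_insert hm, Finset.sum_eq_zero (s := insert m s), zero_add]
    · refine Finset.sum_congr rfl fun i hi => ?_
      rw [Finset.sum_insert hm, min_eq_right (hmin i hi)]
      simp
    · intro j hj
      have : t m ≤ t j := by
        rcases Finset.mem_insert.1 hj with rfl | hj
        exacts [le_rfl, hmin j hj]
      simp [min_eq_left this]
  rw [hsplit, star_sum, Finset.sum_mul_sum, Finset.mul_sum, ← Finset.sum_add_distrib]
  refine Finset.sum_congr rfl fun i _ => ?_
  rw [Finset.mul_sum, ← Finset.sum_add_distrib]
  refine Finset.sum_congr rfl fun j _ => ?_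
  push_cast
  ring

theorem sum_min_sub_nonneg {ι : Type*} [DecidableEq ι] (t : ι → ℝ) (a : ι → ℂ)
    (s : Finset ι) : ∀ c : ℝ, (∀ i ∈ s, c ≤ t i) →
      0 ≤ ∑ i ∈ s, ∑ j ∈ s, star (a i) * ((min (t i) (t j) - c : ℝ) : ℂ) * a j := by
  induction s using Finset.induction_on_min_value t with
  | empty => simp
  | insert m s hm hmin ih =>
    intro c hc
    rw [sum_min_sub_insert t a m s hm hmin c]
    have h := hc m (Finset.mem_insert_self _ _)
    exact add_nonneg (mul_nonneg (Complex.zero_le_real.2 (sub_nonneg.2 h))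
      (star_mul_self_nonneg _)) (ih _ hmin)

theorem sum_min_sub_pos {ι : Type*} [DecidableEq ι] (t : ι → ℝ) (ht : Function.Injective t)
    (a : ι → ℂ) (s : Finset ι) : ∀ c : ℝ, (∀ i ∈ s, c < t i) → (∃ i ∈ s, a i ≠ 0) →
      0 < ∑ i ∈ s, ∑ j ∈ s, star (a i) * ((min (t i) (t j) - c : ℝ) : ℂ) * a j := by
  induction s using Finset.induction_on_min_value t with
  | empty => simp
  | insert m s hm hmin ih =>
    intro c hc ha
    rw [sum_min_sub_insert t a m s hm hmin c]
    have h := hc m (Finset.mem_insert_self _ _)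
    by_cases hs : ∃ i ∈ s, a i ≠ 0
    · refine add_pos_of_nonneg_of_pos (mul_nonneg (Complex.zero_le_real.2 (sub_nonneg.2 h.le))
        (star_mul_self_nonneg _)) (ih _ (fun i hi => (hmin i hi).lt_of_ne fun e => ?_) hs)
      exact hm (ht e ▸ hi)
    · push Not at hs
      have ham : a m ≠ 0 := by
        obtain ⟨i, hi, hai⟩ := ha
        rcases Finset.mem_insert.1 hi with rfl | hi
        exacts [hai, absurd (hs i hi) hai]
      refine add_pos_of_pos_of_nonneg (mul_pos (Complex.zero_lt_real.2 (sub_pos.2 h)) ?_)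
        (sum_min_sub_nonneg t a s _ hmin)
      rw [Finset.sum_insert hm, Finset.sum_eq_zero hs, add_zero]
      exact star_mul_self_pos (IsRegular.of_ne_zero ham)

theorem isHermitian_minKernel {ι : Type*} (t : ι → ℝ) :
    (Matrix.of fun i j => ((min (t i) (t j) : ℝ) : ℂ)).IsHermitian := by
  ext i j
  simp [min_comm]

theorem posSemidef_minKernel {ι : Type*} [Fintype ι] (t : ι → ℝ) (ht : ∀ i, 0 ≤ t i) :
    (Matrix.of fun i j => ((min (t i) (t j) : ℝ) : ℂ)).PosSemidef := by
  classical
  refine .of_dotProduct_mulVec_nonneg (isHermitian_minKernel t) fun a => ?_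
  simpa [dotProduct, mulVec, Finset.mul_sum, mul_assoc] using
    sum_min_sub_nonneg t a Finset.univ 0 fun i _ => ht i

theorem posDef_minKernel {ι : Type*} [Fintype ι] (t : ι → ℝ) (ht : ∀ i, 0 < t i)
    (hinj : Function.Injective t) :
    (Matrix.of fun i j => ((min (t i) (t j) : ℝ) : ℂ)).PosDef := by
  classical
  refine .of_dotProduct_mulVec_pos (isHermitian_minKernel t) fun a ha => ?_
  simpa [dotProduct, mulVec, Finset.mul_sum, mul_assoc] using
    sum_min_sub_pos t hinj a Finset.univ 0 (fun i _ => ht i)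
      (by simpa using Function.ne_iff.1 ha)

theorem exp_neg_mul_abs_sub {η : ℝ} (hη : 0 ≤ η) (x y : ℝ) :
    Real.exp (-η * |x - y|) = Real.exp (-η * x) *
      min (Real.exp (2 * η * x)) (Real.exp (2 * η * y)) * Real.exp (-η * y) := by
  wlog h : x ≤ y generalizing x y
  · rw [abs_sub_comm, this y x (le_of_not_ge h), min_comm]
    ring
  · rw [min_eq_left (Real.exp_le_exp.2 (by gcongr)), ← Real.exp_add, ← Real.exp_add,
      abs_of_nonpos (sub_nonpos.2 h)]
    ring_nf

/-- The diagonal matrix of damped plane waves `e^{(−η + ik) x_j}`. -/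
noncomputable def dampedPhase (n : ℕ) (x : Fin n → ℝ) (k η : ℝ) : Matrix (Fin n) (Fin n) ℂ :=
  diagonal fun j => Complex.exp ((-η * x j : ℝ) + (k * x j : ℝ) * I)

theorem isUnit_dampedPhase (n : ℕ) (x : Fin n → ℝ) (k η : ℝ) :
    IsUnit (dampedPhase n x k η) := by
  rw [dampedPhase, Matrix.isUnit_diagonal, Pi.isUnit_iff]
  exact fun j => (Complex.exp_ne_zero _).isUnit

theorem cosMatrix_eq_smul_add (n : ℕ) (x : Fin n → ℝ) (k η : ℝ) (hη : 0 ≤ η) :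
    cosMatrix n x k η = (1 / 2 : ℝ) •
      ((dampedPhase n x k η)ᴴ * (Matrix.of fun i j =>
          ((min (Real.exp (2 * η * x i)) (Real.exp (2 * η * x j)) : ℝ) : ℂ)) *
          dampedPhase n x k η +
        (dampedPhase n x (-k) η)ᴴ * (Matrix.of fun i j =>
          ((min (Real.exp (2 * η * x i)) (Real.exp (2 * η * x j)) : ℝ) : ℂ)) *
          dampedPhase n x (-k) η) := by
  ext j l
  have hcos : (Real.cos (k * (x j - x l)) : ℂ) =
      (Complex.exp (-(k * x j : ℝ) * I) * Complex.exp ((k * x l : ℝ) * I) +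
        Complex.exp ((k * x j : ℝ) * I) * Complex.exp (-(k * x l : ℝ) * I)) / 2 := by
    rw [Complex.ofReal_cos, Complex.cos, ← Complex.exp_add, ← Complex.exp_add, add_comm]
    push_cast
    ring_nf
  simp only [cosMatrix, dampedPhase, Matrix.of_apply, Matrix.smul_apply, Matrix.add_apply,
    diagonal_conjTranspose, diagonal_mul, mul_diagonal, Pi.star_apply, RCLike.star_def,
    ← Complex.exp_conj, map_mul, Complex.conj_ofReal, Complex.conj_I, Complex.exp_add]
  rw [exp_neg_mul_abs_sub hη, Complex.ofReal_mul, hcos, Complex.real_smul]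
  simp only [neg_mul, mul_neg, Complex.ofReal_neg, neg_neg, Complex.ofReal_mul,
    Complex.ofReal_exp]
  push_cast
  ring

/-- The cosine matrix is positive semidefinite for `η ≥ 0`; it is positive
definite whenever `η > 0` and the points `x₁,…,xₙ` are pairwise distinct. -/
theorem cosMatrix_posSemidef
    (n : ℕ) (x : Fin n → ℝ) (k η : ℝ) (hη : 0 ≤ η) :
    (cosMatrix n x k η).PosSemidef ∧
      (0 < η → Function.Injective x → (cosMatrix n x k η).PosDef) := by
  rw [cosMatrix_eq_smul_add n x k η hη]
  constructor
  · have hK := posSemidef_minKernel (fun i => Real.exp (2 * η * x i))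
      fun i => (Real.exp_pos _).le
    exact ((hK.conjTranspose_mul_mul_same _).add (hK.conjTranspose_mul_mul_same _)).smul
      (by norm_num)
  · intro hpos hx
    have hK := posDef_minKernel (fun i => Real.exp (2 * η * x i)) (fun i => Real.exp_pos _)
      fun i j h => hx (mul_left_cancel₀ (by positivity) (Real.exp_injective h))
    have hconj (κ : ℝ) := hK.conjTranspose_mul_mul_same
      (Matrix.mulVec_injective_of_isUnit (isUnit_dampedPhase n x κ η))
    exact ((hconj k).add (hconj (-k))).smul (by norm_num)
end
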